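/- Let μ be a nonzero uniformly distributed measure on (ℍ^n, d_H) and let s > 0. Then the function F₁ : ℝ^{2n+1} → ℝ defined by F₁(x) = ∫ exp(-s·‖x⁻¹·z‖_H⁴) dμ(z) is real analytic on ℝ^{2n+1} (indeed, it extends to a holomorphic function of the 2n+1 complex variables obtained by replacing the coordinates of x by complex numbers in the explicit polynomial expression for ‖x⁻¹·z‖_H⁴). -/

import Mathlib

open MeasureTheory Set Filter ENNReal NNReal

noncomputable section

/-- The underlying space of the Heisenberg group `ℍⁿ = ℝ²ⁿ × ℝ`. -/
abbrev Heis (n : ℕ) := EuclideanSpace ℝ (Fin (2 * n)) × ℝ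

/-- The symplectic form `A(x',y') = -2 ∑ (x_j y_{j+n} - x_{j+n} y_j)` on `ℝ²ⁿ`. -/
def symp {n : ℕ} (x y : EuclideanSpace ℝ (Fin (2 * n))) : ℝ :=
  -2 * ∑ j : Fin n,
    (x ⟨j.1, by have := j.isLt; omega⟩ * y ⟨j.1 + n, by have := j.isLt; omega⟩ -
     x ⟨j.1 + n, by have := j.isLt; omega⟩ * y ⟨j.1, by have := j.isLt; omega⟩)

/-- The Heisenberg group multiplication. -/
def hmul {n : ℕ} (x y : Heis n) : Heis n := (x.1 + y.1, x.2 + y.2 + symp x.1 y.1)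

/-- The Heisenberg group inverse, `x⁻¹ = -x`. -/
def hinv {n : ℕ} (x : Heis n) : Heis n := (-x.1, -x.2)

/-- The identity element `e = 0`. -/
def eH {n : ℕ} : Heis n := (0, 0)

/-- The Korányi norm `‖x‖_H = (|x'|⁴ + x_{2n+1}²)^{1/4}`. -/
def KNorm {n : ℕ} (x : Heis n) : ℝ := (‖x.1‖ ^ 4 + x.2 ^ 2) ^ ((1 : ℝ) / 4)

/-- The Korányi metric `d_H(x,y) = ‖x⁻¹·y‖_H`. -/
def dH {n : ℕ} (x y : Heis n) : ℝ := KNorm (hmul (hinv x) y)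

/-- The closed `d_H`-ball of center `x` and radius `r`. -/
def ballH {n : ℕ} (x : Heis n) (r : ℝ) : Set (Heis n) := {y | dH x y ≤ r}

/-- The support of a measure with respect to the Korányi metric. -/
def suppH {n : ℕ} (μ : Measure (Heis n)) : Set (Heis n) := {x | ∀ r > 0, 0 < μ (ballH x r)}

/-- A Radon measure is uniformly distributed if all balls centered on its support of
a common radius have the same measure. -/
def UniformlyDistributed {n : ℕ} (μ : Measure (Heis n)) : Prop :=
  ∀ x ∈ suppH μ, ∀ y ∈ suppH μ, ∀ r : ℝ, 0 < r → μ (ballH x r) = μ (ballH y r)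

/-- The dilations `δ_r(x', x_{2n+1}) = (r x', r² x_{2n+1})`. -/
def dil {n : ℕ} (r : ℝ) (x : Heis n) : Heis n := (r • x.1, r ^ 2 * x.2)

/-- `d_H`-diameter of a set, as an extended real. -/
def ediamH {n : ℕ} (E : Set (Heis n)) : ℝ≥0∞ :=
  ⨆ x ∈ E, ⨆ y ∈ E, ENNReal.ofReal (dH x y)

/-- The `s`-dimensional Hausdorff measure built from the Korányi metric `d_H`. -/
def hausH {n : ℕ} (s : ℝ) (E : Set (Heis n)) : ℝ≥0∞ :=
  ⨆ (δ : ℝ) (_ : 0 < δ), ⨅ (t : ℕ → Set (Heis n)) (_ : E ⊆ ⋃ i, t i)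
    (_ : ∀ i, ediamH (t i) ≤ ENNReal.ofReal δ), ∑' i, ediamH (t i) ^ s

/-- The Hausdorff dimension with respect to the Korányi metric `d_H`. -/
def dimHH {n : ℕ} (E : Set (Heis n)) : ℝ≥0∞ :=
  ⨆ (d : ℝ≥0) (_ : hausH (d : ℝ) E = ⊤), (d : ℝ≥0∞)

/-- `Θˢ(μ,x) = d`: the `s`-density of `μ` at `x` exists and equals `d`. -/
def HasDensity {n : ℕ} (μ : Measure (Heis n)) (s : ℝ) (x : Heis n) (d : ℝ≥0∞) : Prop :=
  Tendsto (fun r : ℝ => μ (ballH x r) / ENNReal.ofReal (r ^ s)) (nhdsWithin 0 (Ioi 0)) (nhds d)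


theorem laplace_analytic {W Z : Type*} [NormedAddCommGroup W] [NormedSpace ℝ W]
    [MeasurableSpace Z] (μ : Measure Z) (L : Z → (W →L[ℝ] ℝ)) (wt : Z → ℝ)
    (hL : AEStronglyMeasurable L μ) (hwt : AEStronglyMeasurable wt μ) (hwt0 : ∀ z, 0 ≤ wt z)
    (hint : ∀ δ : ℝ, 0 ≤ δ → Integrable (fun z => Real.exp (δ * ‖L z‖) * wt z) μ) (v : W) :
    AnalyticAt ℝ (fun v => ∫ z, Real.exp (L z v) * wt z ∂μ) v := by
  let q : ∀ k : ℕ, (W →L[ℝ] ℝ) → (W [×k]→L[ℝ] ℝ) := fun k l =>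
    (ContinuousMultilinearMap.mkPiAlgebraFin ℝ k ℝ).compContinuousLinearMap (fun _ => l)
  have hqc : ∀ k, Continuous (q k) := by
    intro k
    have h1 : Continuous (fun l : W →L[ℝ] ℝ =>
        ContinuousMultilinearMap.compContinuousLinearMapContinuousMultilinear ℝ
          (fun _ : Fin k => W) (fun _ : Fin k => ℝ) ℝ (fun _ => l)) :=
      (ContinuousMultilinearMap.cont _).comp (continuous_pi fun _ => continuous_id)
    exact h1.clm_apply continuous_const
  have hqn : ∀ k l, ‖q k l‖ ≤ ‖l‖ ^ k := by
    intro k l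
    refine (ContinuousMultilinearMap.norm_compContinuousLinearMap_le _ _).trans ?_
    simp
  have hqa : ∀ k l (v : W), q k l (fun _ => v) = (l v) ^ k := by
    intro k l v
    simp [q, ContinuousMultilinearMap.compContinuousLinearMap_apply]
  let f : ∀ k : ℕ, Z → (W [×k]→L[ℝ] ℝ) := fun k z => (wt z / (k.factorial : ℝ)) • q k (L z)
  have hfm : ∀ k, AEStronglyMeasurable (f k) μ := fun k =>
    (by simpa only [div_eq_mul_inv] using hwt.mul_const _ : AEStronglyMeasurable (fun z => wt z / _) μ).smul ((hqc k).comp_aestronglyMeasurable hL)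
  have hfn : ∀ k z (r : ℝ), 0 ≤ r → ‖f k z‖ * r ^ k ≤ Real.exp (r * ‖L z‖) * wt z := by
    intro k z r hr
    have h2 : (r * ‖L z‖) ^ k / (k.factorial : ℝ) ≤ Real.exp (r * ‖L z‖) :=
      Real.pow_div_factorial_le_exp _ (by positivity) k
    have h3 : ‖f k z‖ ≤ (wt z / (k.factorial : ℝ)) * ‖L z‖ ^ k := by
      simp only [f, norm_smul]
      rw [Real.norm_of_nonneg (div_nonneg (hwt0 z) (by positivity))]
      exact mul_le_mul_of_nonneg_left (hqn k _) (div_nonneg (hwt0 z) (by positivity))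
    calc ‖f k z‖ * r ^ k ≤ (wt z / (k.factorial : ℝ)) * ‖L z‖ ^ k * r ^ k := by gcongr
      _ = (r * ‖L z‖) ^ k / (k.factorial : ℝ) * wt z := by rw [mul_pow]; ring
      _ ≤ _ := mul_le_mul_of_nonneg_right h2 (hwt0 z)
  have hfi : ∀ k, Integrable (f k) μ := fun k =>
    (hint 1 zero_le_one).mono' (hfm k) (Eventually.of_forall fun z => by
      simpa using hfn k z 1 zero_le_one)
  let p : FormalMultilinearSeries ℝ W ℝ := fun k => ∫ z, f k z ∂μ
  have hp : HasFPowerSeriesOnBall (fun v => ∫ z, Real.exp (L z v) * wt z ∂μ) p 0 ⊤ := by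
    refine ⟨?_, by simp, ?_⟩
    · refine ENNReal.le_of_forall_nnreal_lt fun r _ => ?_
      refine p.le_radius_of_bound (∫ z, Real.exp (r * ‖L z‖) * wt z ∂μ) fun k => ?_
      calc ‖p k‖ * (r : ℝ) ^ k ≤ (∫ z, ‖f k z‖ ∂μ) * (r : ℝ) ^ k := by
            gcongr; exact norm_integral_le_integral_norm _
        _ = ∫ z, ‖f k z‖ * (r : ℝ) ^ k ∂μ := (integral_mul_const _ _).symm
        _ ≤ _ := integral_mono ((hfi k).norm.mul_const _) (hint r r.2) fun z => hfn k z r r.2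
    · intro y _
      have hpk : ∀ k, p k (fun _ => y) = ∫ z, (L z y) ^ k / (k.factorial : ℝ) * wt z ∂μ := by
        intro k
        have := ((ContinuousMultilinearMap.apply ℝ (fun _ : Fin k => W) ℝ
          (fun _ => y))).integral_comp_comm (hfi k)
        simp only [ContinuousMultilinearMap.apply_apply] at this
        rw [← this]
        congr 1; ext z
        simp only [f, smul_apply, hqa, smul_eq_mul]
        ring
      simp only [hpk, zero_add]
      have hexp : ∀ x : ℝ, HasSum (fun k : ℕ => x ^ k / (k.factorial : ℝ)) (Real.exp x) := by
        intro x
        rw [Real.exp_eq_exp_ℝ]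
        exact NormedSpace.expSeries_div_hasSum_exp x
      refine hasSum_integral_of_dominated_convergence
        (fun k z => (‖y‖ * ‖L z‖) ^ k / (k.factorial : ℝ) * wt z) ?_ ?_ ?_ ?_ ?_
      · intro k
        have : AEStronglyMeasurable (fun z => L z y) μ :=
          (ContinuousLinearMap.apply ℝ ℝ y).continuous.comp_aestronglyMeasurable hL
        simp only [div_eq_mul_inv]
        exact ((this.pow k).mul_const _).mul hwt
      · intro k
        refine Eventually.of_forall fun z => ?_
        rw [norm_mul, norm_div, norm_pow, Real.norm_of_nonneg (hwt0 z), Real.norm_natCast]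
        have := (L z).le_opNorm y
        rw [mul_comm] at this
        have := hwt0 z
        gcongr
      · exact Eventually.of_forall fun z => ((hexp _).mul_right _).summable
      · simp only [fun z => ((hexp (‖y‖ * ‖L z‖)).mul_right (wt z)).tsum_eq]
        exact hint _ (norm_nonneg _)
      · exact Eventually.of_forall fun z => (hexp _).mul_right _
  exact hp.analyticAt_of_mem (by simp)

theorem growth_integrable {E : Type*} [NormedAddCommGroup E] [NormedSpace ℝ E]
    [FiniteDimensional ℝ E] [MeasurableSpace E] [BorelSpace E] (μ : Measure E) [SFinite μ]
    (ε : ℝ) (hε : 0 < ε) (hε1 : ε ≤ 1) (H : ℝ≥0∞) (hH : H ≠ ⊤)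
    (h : ∀ z : E, μ {w | ‖z - w‖ * (1 + ‖w‖) ≤ ε} ≤ H) :
    ∃ M : ℕ, ∫⁻ w, ENNReal.ofReal (((1 + ‖w‖) ^ M)⁻¹) ∂μ ≠ ⊤ := by
  let ν : Measure E := Measure.addHaar
  set N := Module.finrank ℝ E with hN
  let g : E → ℝ := fun z => ((1 + ‖z‖) ^ (N + 1))⁻¹
  have hgi : Integrable g ν := by
    have := integrable_one_add_norm (μ := ν) (r := ((N + 1 : ℕ) : ℝ)) (by rw [← hN]; push_cast; linarith)
    refine this.congr (Eventually.of_forall fun z => ?_)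
    have : (0:ℝ) ≤ 1 + ‖z‖ := by positivity
    simp only [g]
    rw [Real.rpow_neg this, Real.rpow_natCast]
  have hgfin : ∫⁻ z, ENNReal.ofReal (g z) ∂ν ≠ ⊤ := hgi.lintegral_lt_top.ne
  let S : Set (E × E) := {p | ‖p.1 - p.2‖ * (1 + ‖p.2‖) ≤ ε}
  have hS : MeasurableSet S := by
    apply IsClosed.measurableSet
    exact isClosed_le (by fun_prop) (by fun_prop)
  have hgm : Measurable g := by
    have : Continuous g := by
      refine Continuous.inv₀ (by fun_prop) fun z => ?_
      positivity
    exact this.measurable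
  let K : E → E → ℝ≥0∞ := fun z w => S.indicator (fun p => ENNReal.ofReal (g p.1)) (z, w)
  have hK : Measurable (Function.uncurry K) := by
    have : Function.uncurry K = S.indicator (fun p => ENNReal.ofReal (g p.1)) := by
      ext ⟨a, b⟩; rfl
    rw [this]
    exact (ENNReal.measurable_ofReal.comp (hgm.comp measurable_fst)).indicator hS
  have hswap : ∫⁻ z, ∫⁻ w, K z w ∂μ ∂ν = ∫⁻ w, ∫⁻ z, K z w ∂ν ∂μ :=
    lintegral_lintegral_swap hK.aemeasurable
  have hup : ∫⁻ z, ∫⁻ w, K z w ∂μ ∂ν ≤ (∫⁻ z, ENNReal.ofReal (g z) ∂ν) * H := by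
    rw [← lintegral_mul_const' _ _ hH]
    refine lintegral_mono fun z => ?_
    have hSz : MeasurableSet {w | ‖z - w‖ * (1 + ‖w‖) ≤ ε} :=
      (isClosed_le (by fun_prop) (by fun_prop)).measurableSet
    have : ∀ w, K z w = ({w | ‖z - w‖ * (1 + ‖w‖) ≤ ε}).indicator
        (fun _ => ENNReal.ofReal (g z)) w := fun w => by
      simp only [K, S, Set.indicator, Set.mem_ofPred_eq]
    simp only [this]
    rw [lintegral_indicator_const hSz]
    gcongr
    exact h z
  set c : ℝ≥0∞ := ENNReal.ofReal (((2:ℝ) ^ (N+1))⁻¹ * ε ^ N) * ν (Metric.ball 0 1) with hc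
  have hc0 : c ≠ 0 := by
    refine mul_ne_zero ?_ (Metric.measure_ball_pos ν 0 one_pos).ne'
    rw [Ne, ENNReal.ofReal_eq_zero, not_le]; positivity
  have hct : c ≠ ⊤ := ENNReal.mul_ne_top ENNReal.ofReal_ne_top measure_ball_lt_top.ne
  refine ⟨N + 1 + N, ?_⟩
  have hlow : ∀ w, c * ENNReal.ofReal (((1 + ‖w‖) ^ (N + 1 + N))⁻¹) ≤ ∫⁻ z, K z w ∂ν := by
    intro w
    have hw : (0:ℝ) < 1 + ‖w‖ := by positivity
    set B := Metric.closedBall w (ε / (1 + ‖w‖)) with hB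
    calc c * ENNReal.ofReal (((1 + ‖w‖) ^ (N + 1 + N))⁻¹)
        = ENNReal.ofReal ((2 ^ (N+1) * (1 + ‖w‖) ^ (N + 1))⁻¹) * ν B := by
          rw [hB, Measure.addHaar_closedBall ν w (by positivity), hc, ← mul_assoc,
            ← ENNReal.ofReal_mul (by positivity), mul_right_comm,
            ← ENNReal.ofReal_mul (by positivity)]
          congr 2
          rw [← hN]
          rw [div_pow, pow_add _ (N + 1) N]
          field_simp
      _ = ∫⁻ z, B.indicator (fun _ => ENNReal.ofReal ((2 ^ (N+1) * (1 + ‖w‖) ^ (N + 1))⁻¹)) z ∂ν := by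
          rw [lintegral_indicator_const Metric.isClosed_closedBall.measurableSet]
      _ ≤ _ := by
          refine lintegral_mono fun z => ?_
          by_cases hz : z ∈ B
          · have hz' : ‖z - w‖ ≤ ε / (1 + ‖w‖) := by
              rw [← dist_eq_norm]; exact Metric.mem_closedBall.1 hz
            have hzS : (z, w) ∈ S := (le_div_iff₀ hw).1 hz'
            simp only [K, Set.indicator_of_mem hz, Set.indicator_of_mem hzS]
            refine ENNReal.ofReal_le_ofReal ?_
            simp only [g]
            have h1 : ε / (1 + ‖w‖) ≤ 1 := (div_le_one hw).2 (by linarith [norm_nonneg w])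
            have h2 : ‖z‖ ≤ ‖z - w‖ + ‖w‖ := by simpa using norm_add_le (z - w) w
            rw [← mul_pow]
            gcongr
            linarith [norm_nonneg w]
          · simp [Set.indicator_of_notMem hz]
  have : c * ∫⁻ w, ENNReal.ofReal (((1 + ‖w‖) ^ (N + 1 + N))⁻¹) ∂μ
      ≤ (∫⁻ z, ENNReal.ofReal (g z) ∂ν) * H := by
    rw [← lintegral_const_mul' _ _ hct]
    exact (lintegral_mono hlow).trans (hswap ▸ hup)
  intro htop
  rw [htop, ENNReal.mul_top hc0, top_le_iff] at this
  exact ENNReal.mul_ne_top hgfin hH this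

theorem laplace_analytic_cont {W Z : Type*} [NormedAddCommGroup W] [NormedSpace ℝ W]
    [TopologicalSpace Z] [SecondCountableTopology Z] [MeasurableSpace Z] [BorelSpace Z]
    [TopologicalSpace.PseudoMetrizableSpace Z] (μ : Measure Z)
    (L : Z → (W →L[ℝ] ℝ)) (wt : Z → ℝ)
    (hL : Continuous L) (hwt : Continuous wt) (hwt0 : ∀ z, 0 ≤ wt z)
    (hint : ∀ δ : ℝ, 0 ≤ δ → Integrable (fun z => Real.exp (δ * ‖L z‖) * wt z) μ) (v : W) :
    AnalyticAt ℝ (fun v => ∫ z, Real.exp (L z v) * wt z ∂μ) v :=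
  laplace_analytic μ L wt hL.aestronglyMeasurable hwt.aestronglyMeasurable hwt0 hint v

set_option maxSynthPendingDepth 6 in
theorem quad_laplace_analytic {V Z : Type*} [NormedAddCommGroup V] [NormedSpace ℝ V]
    [TopologicalSpace Z] [SecondCountableTopology Z] [MeasurableSpace Z] [BorelSpace Z]
    [TopologicalSpace.PseudoMetrizableSpace Z] (μ : Measure Z)
    (s : ℝ) (hs : 0 < s) (q t : Z → ℝ) (l1 l2 : Z → (V →L[ℝ] ℝ)) (wt : Z → ℝ)
    (hq : Continuous q) (ht : Continuous t) (hl1 : Continuous l1) (hl2 : Continuous l2)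
    (hwt : Continuous wt) (hwt0 : ∀ z, 0 ≤ wt z)
    (hint : ∀ δ : ℝ, 0 ≤ δ → Integrable (fun z => Real.exp (δ * (s * (2 * |q z| * ‖l1 z‖ +
      2 * |t z| * ‖l2 z‖ + (‖l1 z‖ ^ 2 + ‖l2 z‖ ^ 2)))) * wt z) μ) (e : V) :
    AnalyticAt ℝ (fun e => ∫ z, Real.exp (-s * (2 * q z * l1 z e + 2 * t z * l2 z e
      + (l1 z e ^ 2 + l2 z e ^ 2))) * wt z ∂μ) e := by
  let VD := V →L[ℝ] ℝ
  let ev : VD → (VD →L[ℝ] VD →L[ℝ] ℝ) →L[ℝ] ℝ := fun l =>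
    (ContinuousLinearMap.apply ℝ ℝ l).comp (ContinuousLinearMap.apply ℝ (VD →L[ℝ] ℝ) l)
  have hevc : Continuous ev := ((ContinuousLinearMap.apply ℝ ℝ).continuous).clm_comp
    ((ContinuousLinearMap.apply ℝ (VD →L[ℝ] ℝ)).continuous)
  have hevn : ∀ l, ‖ev l‖ ≤ ‖l‖ ^ 2 := by
    intro l
    refine ContinuousLinearMap.opNorm_le_bound _ (by positivity) fun b => ?_
    change ‖b l l‖ ≤ _
    refine (b.le_opNorm₂ l l).trans (le_of_eq ?_)
    ring
  let L : Z → ((V × (VD →L[ℝ] VD →L[ℝ] ℝ)) →L[ℝ] ℝ) := fun z =>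
    (-s) • (((2 * q z) • l1 z + (2 * t z) • l2 z).comp (ContinuousLinearMap.fst ℝ _ _) +
    (ev (l1 z) + ev (l2 z)).comp (ContinuousLinearMap.snd ℝ _ _))
  have hLa : ∀ z w, L z w = -s * (2 * q z * l1 z w.1 + 2 * t z * l2 z w.1
      + (w.2 (l1 z) (l1 z) + w.2 (l2 z) (l2 z))) := fun z w => rfl
  have hLc : Continuous L := by
    have a1 : Continuous (fun z => (2 * q z) • l1 z + (2 * t z) • l2 z) := by fun_prop
    have a2 : Continuous (fun z => ev (l1 z) + ev (l2 z)) := (hevc.comp hl1).add (hevc.comp hl2)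
    have b1 := a1.clm_comp (continuous_const (y :=
      ContinuousLinearMap.fst ℝ V (VD →L[ℝ] VD →L[ℝ] ℝ)))
    have b2 := a2.clm_comp (continuous_const (y :=
      ContinuousLinearMap.snd ℝ V (VD →L[ℝ] VD →L[ℝ] ℝ)))
    exact (b1.add b2).const_smul (-s)
  have hLn : ∀ z, ‖L z‖ ≤ s * (2 * |q z| * ‖l1 z‖ +
      2 * |t z| * ‖l2 z‖ + (‖l1 z‖ ^ 2 + ‖l2 z‖ ^ 2)) := by
    intro z
    refine ContinuousLinearMap.opNorm_le_bound _ (by positivity) fun w => ?_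
    rw [hLa, norm_mul, norm_neg, Real.norm_of_nonneg hs.le, mul_assoc s]
    gcongr
    have w1 : ‖w.1‖ ≤ ‖w‖ := norm_fst_le w
    have w2 : ‖w.2‖ ≤ ‖w‖ := norm_snd_le w
    have b : ∀ l : VD, ‖w.2 l l‖ ≤ ‖l‖ ^ 2 * ‖w‖ := by
      intro l
      refine (w.2.le_opNorm₂ l l).trans ?_
      calc ‖w.2‖ * ‖l‖ * ‖l‖ = ‖l‖ ^ 2 * ‖w.2‖ := by ring
        _ ≤ _ := by gcongr
    have c : ∀ (a : ℝ) (l : VD), ‖2 * a * l w.1‖ ≤ 2 * |a| * ‖l‖ * ‖w‖ := by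
      intro a l
      rw [norm_mul, norm_mul, Real.norm_two, Real.norm_eq_abs a]
      have := (l.le_opNorm w.1).trans (mul_le_mul_of_nonneg_left w1 (norm_nonneg l))
      calc 2 * |a| * ‖l w.1‖ ≤ 2 * |a| * (‖l‖ * ‖w‖) := by gcongr
        _ = _ := by ring
    have := norm_add₃_le (a := 2 * q z * l1 z w.1) (b := 2 * t z * l2 z w.1)
      (c := w.2 (l1 z) (l1 z) + w.2 (l2 z) (l2 z))
    have := norm_add_le (w.2 (l1 z) (l1 z)) (w.2 (l2 z) (l2 z))
    linarith [b (l1 z), b (l2 z), c (q z) (l1 z), c (t z) (l2 z)]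
  let phi : V → V × (VD →L[ℝ] VD →L[ℝ] ℝ) := fun e =>
    (e, ContinuousLinearMap.smulRightL ℝ VD (VD →L[ℝ] ℝ)
      (ContinuousLinearMap.apply ℝ ℝ e) (ContinuousLinearMap.apply ℝ ℝ e))
  have hphi : AnalyticAt ℝ phi e := by
    have h2 : AnalyticAt ℝ (fun e : V => (ContinuousLinearMap.apply ℝ ℝ e : VD →L[ℝ] ℝ)) e :=
      (ContinuousLinearMap.apply ℝ ℝ (E := V)).analyticAt _
    refine analyticAt_id.prod ?_
    exact ((ContinuousLinearMap.smulRightL ℝ VD (VD →L[ℝ] ℝ)).analyticAt_bilinear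
      (_, _)).comp (f := fun e : V => ((ContinuousLinearMap.apply ℝ ℝ e : VD →L[ℝ] ℝ),
        (ContinuousLinearMap.apply ℝ ℝ e : VD →L[ℝ] ℝ))) (h2.prod h2)
  have key := laplace_analytic_cont μ L wt hLc hwt hwt0 (by
    intro δ hδ
    refine (hint δ hδ).mono' ?_ (Eventually.of_forall fun z => ?_)
    · exact ((Real.continuous_exp.comp (continuous_const.mul hLc.norm)).mul
        hwt).aestronglyMeasurable
    · have := hwt0 z
      rw [Real.norm_of_nonneg (by positivity)]
      gcongr
      exact hLn z) (phi e)
  refine (key.comp hphi).congr (Eventually.of_forall fun y => ?_)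
  simp only [Function.comp_def, hLa]
  congr 1; ext z
  have hb : ∀ l : VD, (phi y).2 l l = (l y) ^ 2 := by
    intro l
    rw [sq]
    rfl
  rw [hb, hb]

theorem real_bound (s D C M : ℝ) (hs : 0 < s) (hD : 0 ≤ D) (hC : 0 ≤ C) (hM : 0 ≤ M) :
    ∃ K : ℝ, ∀ R t : ℝ, 0 ≤ R → 0 ≤ t →
      D * (2 * R ^ 2 * (2 * R + 1) + 2 * t * (1 + C * R) + (2 * R + 1) ^ 2 + (1 + C * R) ^ 2)
        + M * (R + t) ≤ s * (R ^ 4 + t ^ 2) + K := by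
  set c2 : ℝ := 6 * D + D * C ^ 2 + 4 * D ^ 2 * C ^ 2 / (4 * s) with hc2
  set c1 : ℝ := 4 * D + 2 * D * C + M + (2 * D + M) * (4 * D * C) / (4 * s) with hc1
  set c0 : ℝ := 2 * D + (2 * D + M) ^ 2 / (4 * s) with hc0
  set c : ℝ := 4 * D + c2 + c1 with hc
  have h2 : 0 ≤ c2 := by positivity
  have h1 : 0 ≤ c1 := by positivity
  have hcn : 0 ≤ c := by positivity
  refine ⟨c0 + c2 + c1 + c * (c / s) ^ 3, fun R t hR ht => ?_⟩
  have hy : t * (2 * D * (1 + C * R) + M)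
      ≤ s * t ^ 2 + (2 * D * (1 + C * R) + M) ^ 2 / (4 * s) := by
    have : s * t ^ 2 + (2 * D * (1 + C * R) + M) ^ 2 / (4 * s) - t * (2 * D * (1 + C * R) + M)
      = (2 * s * t - (2 * D * (1 + C * R) + M)) ^ 2 / (4 * s) := by
      field_simp; ring
    have h0 : 0 ≤ (2 * s * t - (2 * D * (1 + C * R) + M)) ^ 2 / (4 * s) := by positivity
    linarith
  have hR2 : R ^ 2 ≤ 1 + R ^ 3 := by
    rcases le_total R 1 with h | h
    · nlinarith [pow_nonneg hR 3]
    · nlinarith [sq_nonneg R]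
  have hR1 : R ≤ 1 + R ^ 3 := by
    rcases le_total R 1 with h | h
    · nlinarith [pow_nonneg hR 3]
    · nlinarith [sq_nonneg R]
  have hcR : c * R ^ 3 ≤ s * R ^ 4 + c * (c / s) ^ 3 := by
    rcases le_total R (c / s) with h | h
    · have : c * R ^ 3 ≤ c * (c / s) ^ 3 := by gcongr
      have : 0 ≤ s * R ^ 4 := by positivity
      linarith
    · have h' : c ≤ R * s := (div_le_iff₀ hs).1 h
      have : c * R ^ 3 ≤ (R * s) * R ^ 3 := by gcongr
      have : 0 ≤ c * (c / s) ^ 3 := by positivity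
      nlinarith
  have heq : D * (2 * R ^ 2 * (2 * R + 1) + (2 * R + 1) ^ 2 + (1 + C * R) ^ 2) + M * R
      + (2 * D * (1 + C * R) + M) ^ 2 / (4 * s) = 4 * D * R ^ 3 + c2 * R ^ 2 + c1 * R + c0 := by
    rw [hc2, hc1, hc0]; field_simp; ring
  have e2 := mul_le_mul_of_nonneg_left hR2 h2
  have e1 := mul_le_mul_of_nonneg_left hR1 h1
  nlinarith

theorem abs_symp_le {n : ℕ} (x y : EuclideanSpace ℝ (Fin (2 * n))) :
    |symp x y| ≤ 4 * n * ‖x‖ * ‖y‖ := by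
  unfold symp
  rw [abs_mul]
  have hx : ∀ i, |x i| ≤ ‖x‖ := fun i => PiLp.norm_apply_le x i
  have hy : ∀ i, |y i| ≤ ‖y‖ := fun i => PiLp.norm_apply_le y i
  have : |∑ j : Fin n,
    (x ⟨j.1, by have := j.isLt; omega⟩ * y ⟨j.1 + n, by have := j.isLt; omega⟩ -
     x ⟨j.1 + n, by have := j.isLt; omega⟩ * y ⟨j.1, by have := j.isLt; omega⟩)|
      ≤ ∑ j : Fin n, (2 * ‖x‖ * ‖y‖) := by
    refine (Finset.abs_sum_le_sum_abs _ _).trans (Finset.sum_le_sum fun j _ => ?_)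
    refine (abs_sub _ _).trans ?_
    rw [abs_mul, abs_mul]
    have h1 : ∀ i k, |x i| * |y k| ≤ ‖x‖ * ‖y‖ := fun i k =>
      mul_le_mul (hx i) (hy k) (abs_nonneg _) (norm_nonneg _)
    linarith [h1 ⟨j.1, by have := j.isLt; omega⟩ ⟨j.1 + n, by have := j.isLt; omega⟩,
      h1 ⟨j.1 + n, by have := j.isLt; omega⟩ ⟨j.1, by have := j.isLt; omega⟩]
  simp only [Finset.sum_const, Finset.card_univ, Fintype.card_fin, nsmul_eq_mul] at this
  rw [abs_neg, abs_two]
  linarith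

theorem symp_neg_left {n : ℕ} (x y : EuclideanSpace ℝ (Fin (2 * n))) :
    symp (-x) y = - symp x y := by
  unfold symp
  rw [← mul_neg, ← Finset.sum_neg_distrib]
  congr 1
  refine Finset.sum_congr rfl fun j _ => ?_
  simp only [PiLp.neg_apply]; ring

theorem symp_sub_self {n : ℕ} (x y : EuclideanSpace ℝ (Fin (2 * n))) :
    symp x (y - x) = symp x y := by
  unfold symp
  congr 1
  refine Finset.sum_congr rfl fun j _ => ?_
  simp only [PiLp.sub_apply]; ring

/-- `a ↦ symp a y` as a continuous linear map. -/
def sympL {n : ℕ} (y : EuclideanSpace ℝ (Fin (2 * n))) :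
    EuclideanSpace ℝ (Fin (2 * n)) →L[ℝ] ℝ :=
  (-2 : ℝ) • ∑ j : Fin n,
    (y ⟨j.1 + n, by have := j.isLt; omega⟩ •
        EuclideanSpace.proj (𝕜 := ℝ) (⟨j.1, by have := j.isLt; omega⟩ : Fin (2 * n)) -
     y ⟨j.1, by have := j.isLt; omega⟩ •
        EuclideanSpace.proj (𝕜 := ℝ) (⟨j.1 + n, by have := j.isLt; omega⟩ : Fin (2 * n)))

theorem sympL_apply {n : ℕ} (y a : EuclideanSpace ℝ (Fin (2 * n))) :
    sympL y a = symp a y := by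
  unfold sympL symp
  simp only [smul_apply, sum_apply, sub_apply, smul_eq_mul]
  congr 1
  refine Finset.sum_congr rfl fun j _ => ?_
  change _ * a _ - _ * a _ = _
  ring

theorem continuous_sympL {n : ℕ} :
    Continuous (sympL : EuclideanSpace ℝ (Fin (2 * n)) → _) := by
  unfold sympL
  fun_prop

theorem KNorm_pow {n : ℕ} (x : Heis n) : KNorm x ^ 4 = ‖x.1‖ ^ 4 + x.2 ^ 2 := by
  unfold KNorm
  rw [← Real.rpow_natCast, ← Real.rpow_mul (by positivity)]
  norm_num

theorem KNorm_nonneg {n : ℕ} (x : Heis n) : 0 ≤ KNorm x := by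
  unfold KNorm; positivity

theorem dH_pow {n : ℕ} (x y : Heis n) :
    dH x y ^ 4 = ‖y.1 - x.1‖ ^ 4 + (y.2 - x.2 - symp x.1 (y.1 - x.1)) ^ 2 := by
  unfold dH
  rw [KNorm_pow]
  simp only [hmul, hinv, symp_neg_left, symp_sub_self]
  rw [neg_add_eq_sub]
  ring

theorem dH_le_one {n : ℕ} (x y : Heis n) :
    dH x y ≤ 1 ↔ ‖y.1 - x.1‖ ^ 4 + (y.2 - x.2 - symp x.1 (y.1 - x.1)) ^ 2 ≤ 1 := by
  rw [← dH_pow, pow_le_one_iff_of_nonneg (show 0 ≤ dH x y from KNorm_nonneg _) (by norm_num)]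

theorem ballH_mem_nhds {n : ℕ} (x : Heis n) (r : ℝ) (hr : 0 < r) : ballH x r ∈ nhds x := by
  have hc : Continuous (fun y => dH x y) := by
    unfold dH KNorm hmul hinv symp
    refine Continuous.rpow_const (by fun_prop) (fun _ => Or.inr (by norm_num))
  have h0 : dH x x = 0 := by
    have := dH_pow x x
    have hs : symp x.1 (x.1 - x.1) = 0 := by simp [symp]
    rw [hs] at this
    simpa using this
  have : ∀ᶠ y in nhds x, dH x y < r := hc.continuousAt.eventually_lt continuousAt_const (by simpa [h0])
  filter_upwards [this] with y hy
  exact hy.le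

theorem suppH_compl_null {n : ℕ} (μ : Measure (Heis n)) : μ (suppH μ)ᶜ = 0 := by
  refine measure_null_of_locally_null _ fun x hx => ?_
  simp only [suppH, Set.mem_compl_iff, Set.mem_ofPred_eq, not_forall, not_lt, nonpos_iff_eq_zero] at hx
  obtain ⟨r, hr, h⟩ := hx
  exact ⟨ballH x r, mem_nhdsWithin_of_mem_nhds (ballH_mem_nhds x r hr), h⟩

theorem ballH_one_lt_top {n : ℕ} (μ : Measure (Heis n)) [IsFiniteMeasureOnCompacts μ]
    (p : Heis n) : μ (ballH p 1) < ⊤ := by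
  have hsub : ballH p 1 ⊆ Metric.closedBall p (1 + 4 * n * ‖p.1‖) := by
    intro w hw
    have hw' := (dH_le_one p w).1 hw
    have h1 : ‖w.1 - p.1‖ ≤ 1 := by
      rw [← pow_le_one_iff_of_nonneg (norm_nonneg _) (n := 4) (by norm_num)]
      nlinarith [sq_nonneg (w.2 - p.2 - symp p.1 (w.1 - p.1))]
    have h2 : |w.2 - p.2 - symp p.1 (w.1 - p.1)| ≤ 1 := by
      rw [← sq_le_one_iff_abs_le_one]
      nlinarith [pow_nonneg (norm_nonneg (w.1 - p.1)) 4]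
    have h3 := abs_symp_le p.1 (w.1 - p.1)
    have h4 : 4 * n * ‖p.1‖ * ‖w.1 - p.1‖ ≤ 4 * n * ‖p.1‖ :=
      mul_le_of_le_one_right (by positivity) h1
    have h5 : 0 ≤ 4 * n * ‖p.1‖ := by positivity
    rw [Metric.mem_closedBall, dist_eq_norm, Prod.norm_def]
    refine max_le (by simpa using h1.trans (by linarith)) ?_
    simp only [Prod.snd_sub, Real.norm_eq_abs]
    rw [abs_le] at *
    constructor <;> linarith
  exact (measure_mono hsub).trans_lt (isCompact_closedBall _ _).measure_lt_top

theorem ud_integrable {n : ℕ} (μ : Measure (Heis n)) [μ.Regular]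
    (hud : UniformlyDistributed μ) :
    ∃ M : ℕ, ∫⁻ w, ENNReal.ofReal (((1 + ‖w‖) ^ M)⁻¹) ∂μ ≠ ⊤ := by
  obtain ⟨H, hH, hb⟩ : ∃ H : ℝ≥0∞, H ≠ ⊤ ∧ ∀ p ∈ suppH μ, μ (ballH p 1) ≤ H := by
    by_cases h : (suppH μ).Nonempty
    · obtain ⟨p0, hp0⟩ := h
      exact ⟨_, (ballH_one_lt_top μ p0).ne, fun p hp => (hud p hp p0 hp0 1 one_pos).le⟩
    · exact ⟨0, by simp, fun p hp => absurd ⟨p, hp⟩ h⟩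
  set C : ℝ := 4 * n with hC
  have hC0 : 0 ≤ C := by positivity
  set ε : ℝ := 1 / (8 * (1 + C)) with hε
  have hεC : ε * (8 * (1 + C)) = 1 := by rw [hε]; field_simp
  have hε0 : 0 < ε := by positivity
  have hε8 : ε ≤ 1 / 8 := by nlinarith
  have hCε : C * ε ≤ 1 / 8 := by nlinarith
  refine growth_integrable μ ε hε0 (by linarith) H hH fun z => ?_
  by_cases hne : ({w | ‖z - w‖ * (1 + ‖w‖) ≤ ε} ∩ suppH μ).Nonempty
  · obtain ⟨p, hpz, hp⟩ := hne
    refine (measure_mono fun w hw => ?_).trans (hb p hp)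
    change ‖z - p‖ * (1 + ‖p‖) ≤ ε at hpz
    change ‖z - w‖ * (1 + ‖w‖) ≤ ε at hw
    refine (dH_le_one p w).2 ?_
    have t1 : ‖w - p‖ ≤ ‖z - w‖ + ‖z - p‖ := by
      have := norm_sub_le (z - p) (z - w)
      rw [show z - p - (z - w) = w - p by abel] at this
      linarith
    have t2 : ‖p‖ ≤ ‖w‖ + ‖w - p‖ := by
      have := norm_sub_le w (w - p)
      rwa [show w - (w - p) = p by abel] at this
    have np := norm_nonneg p
    have nw := norm_nonneg w
    have nzp := norm_nonneg (z - p)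
    have nzw := norm_nonneg (z - w)
    have a1 : ‖z - p‖ ≤ ε := by nlinarith
    have a2 : ‖z - w‖ ≤ ε := by nlinarith
    have d2 : ‖w - p‖ ≤ 2 * ε := by linarith
    have d3 : ‖p‖ * ‖w - p‖ ≤ 3 * ε := by
      have b1 : ‖p‖ * ‖w - p‖ ≤ ‖p‖ * (‖z - w‖ + ‖z - p‖) := by gcongr
      have b2 : ‖p‖ * ‖z - w‖ ≤ (‖w‖ + 2 * ε) * ‖z - w‖ := by gcongr; linarith
      nlinarith
    have e1 : ‖w.1 - p.1‖ ≤ ‖w - p‖ := norm_fst_le (w - p)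
    have e2 : |w.2 - p.2| ≤ ‖w - p‖ := norm_snd_le (w - p)
    have e3 : ‖p.1‖ ≤ ‖p‖ := norm_fst_le p
    have e4 : |symp p.1 (w.1 - p.1)| ≤ 3 / 8 := by
      calc |symp p.1 (w.1 - p.1)| ≤ C * ‖p.1‖ * ‖w.1 - p.1‖ := abs_symp_le _ _
        _ ≤ C * ‖p‖ * ‖w - p‖ := by gcongr
        _ = C * (‖p‖ * ‖w - p‖) := by ring
        _ ≤ C * (3 * ε) := by gcongr
        _ ≤ 3 / 8 := by linarith
    have e5 : |w.2 - p.2 - symp p.1 (w.1 - p.1)| ≤ 5 / 8 := by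
      refine (abs_sub _ _).trans ?_
      linarith
    have e6 : (w.2 - p.2 - symp p.1 (w.1 - p.1)) ^ 2 ≤ (5 / 8) ^ 2 := by
      rw [← sq_abs]; gcongr
    have e7 : ‖w.1 - p.1‖ ^ 4 ≤ (1 / 4) ^ 4 := by gcongr; linarith
    norm_num at e6 e7 ⊢
    linarith
  · have hsub : {w | ‖z - w‖ * (1 + ‖w‖) ≤ ε} ⊆ (suppH μ)ᶜ := fun w hw hs => hne ⟨w, hw, hs⟩
    rw [measure_mono_null hsub (suppH_compl_null μ)]
    exact zero_le

section final

/-- The auxiliary space carrying `(x', x_{2n+1}, |x'|²)`. -/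
abbrev VV (n : ℕ) := EuclideanSpace ℝ (Fin (2 * n)) × ℝ × ℝ

/-- First linear form. -/
def ell1 {n : ℕ} (z : Heis n) : VV n →L[ℝ] ℝ :=
  (-2 : ℝ) • (innerSL ℝ z.1).comp (ContinuousLinearMap.fst ℝ _ _) +
    (ContinuousLinearMap.snd ℝ ℝ ℝ).comp (ContinuousLinearMap.snd ℝ _ _)

/-- Second linear form. -/
def ell2 {n : ℕ} (z : Heis n) : VV n →L[ℝ] ℝ :=
  -(ContinuousLinearMap.fst ℝ ℝ ℝ).comp (ContinuousLinearMap.snd ℝ _ _) -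
    (sympL z.1).comp (ContinuousLinearMap.fst ℝ _ _)

theorem ell1_apply {n : ℕ} (z : Heis n) (e : VV n) :
    ell1 z e = -2 * inner ℝ z.1 e.1 + e.2.2 := by simp [ell1]

theorem ell2_apply {n : ℕ} (z : Heis n) (e : VV n) :
    ell2 z e = -e.2.1 - symp e.1 z.1 := by simp [ell2, sympL_apply]

theorem continuous_ell1 {n : ℕ} : Continuous (ell1 : Heis n → _) := by
  unfold ell1; fun_prop

theorem continuous_ell2 {n : ℕ} : Continuous (ell2 : Heis n → _) := by
  unfold ell2
  have := continuous_sympL (n := n)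
  fun_prop

theorem norm_ell1_le {n : ℕ} (z : Heis n) : ‖ell1 z‖ ≤ 2 * ‖z.1‖ + 1 := by
  refine ContinuousLinearMap.opNorm_le_bound _ (by positivity) fun e => ?_
  rw [ell1_apply, Real.norm_eq_abs]
  have h1 := abs_real_inner_le_norm z.1 e.1
  have h2 : ‖e.1‖ ≤ ‖e‖ := norm_fst_le e
  have h3 : |e.2.2| ≤ ‖e‖ := (norm_snd_le e.2).trans (norm_snd_le e)
  have h4 : ‖z.1‖ * ‖e.1‖ ≤ ‖z.1‖ * ‖e‖ := by gcongr
  refine (abs_add_le _ _).trans ?_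
  rw [abs_mul, abs_neg, abs_two]
  linarith

theorem norm_ell2_le {n : ℕ} (z : Heis n) : ‖ell2 z‖ ≤ 1 + 4 * n * ‖z.1‖ := by
  refine ContinuousLinearMap.opNorm_le_bound _ (by positivity) fun e => ?_
  rw [ell2_apply, Real.norm_eq_abs]
  have h1 := abs_symp_le e.1 z.1
  have h2 : ‖e.1‖ ≤ ‖e‖ := norm_fst_le e
  have h3 : |e.2.1| ≤ ‖e‖ := (norm_fst_le e.2).trans (norm_snd_le e)
  have h4 : 4 * n * ‖e.1‖ * ‖z.1‖ ≤ 4 * n * ‖e‖ * ‖z.1‖ := by gcongr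
  refine (abs_sub _ _).trans ?_
  rw [abs_neg]
  linarith

/-- Feature map. -/
def ee {n : ℕ} (x : Heis n) : VV n := (x.1, x.2, ‖x.1‖ ^ 2)

theorem analyticAt_ee {n : ℕ} (x : Heis n) : AnalyticAt ℝ (ee : Heis n → VV n) x := by
  unfold ee
  have h : AnalyticAt ℝ (fun x : Heis n => ‖x.1‖ ^ 2) x := by
    have := ((innerSL ℝ (E := EuclideanSpace ℝ (Fin (2 * n)))).analyticAt_bilinear (x.1, x.1)).comp
      (f := fun x : Heis n => (x.1, x.1)) (x := x) (analyticAt_fst.prod analyticAt_fst)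
    refine this.congr (Eventually.of_forall fun y => ?_)
    exact real_inner_self_eq_norm_sq y.1
  exact analyticAt_fst.prod (analyticAt_snd.prod h)

theorem exponent_eq {n : ℕ} (s : ℝ) (x z : Heis n) :
    -s * KNorm (hmul (hinv x) z) ^ 4 = -s * (2 * ‖z.1‖ ^ 2 * ell1 z (ee x) +
      2 * z.2 * ell2 z (ee x) + (ell1 z (ee x) ^ 2 + ell2 z (ee x) ^ 2))
      + -s * (‖z.1‖ ^ 4 + z.2 ^ 2) := by
  rw [KNorm_pow]
  have h1 : ‖(hmul (hinv x) z).1‖ ^ 2 = ‖z.1‖ ^ 2 + ell1 z (ee x) := by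
    simp only [hmul, hinv, ell1_apply, ee]
    rw [neg_add_eq_sub, norm_sub_sq_real]
    ring
  have h2 : (hmul (hinv x) z).2 = z.2 + ell2 z (ee x) := by
    simp only [hmul, hinv, ell2_apply, ee, symp_neg_left]
    ring
  have h3 : ‖(hmul (hinv x) z).1‖ ^ 4 = (‖(hmul (hinv x) z).1‖ ^ 2) ^ 2 := by ring
  rw [h3, h1, h2]
  ring

end final

/-- For a nonzero uniformly distributed measure `μ` on `(ℍⁿ, d_H)` and `s > 0`, the
function `F₁(x) = ∫ exp(-s ‖x⁻¹·z‖_H⁴) dμ(z)` is real analytic on `ℝ^{2n+1}`. -/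
theorem statement6 (n : ℕ) (μ : Measure (Heis n)) [μ.Regular] (hμ : μ ≠ 0)
    (hud : UniformlyDistributed μ) (s : ℝ) (hs : 0 < s) :
    ∀ x : Heis n,
      AnalyticAt ℝ (fun x : Heis n => ∫ z, Real.exp (-s * KNorm (hmul (hinv x) z) ^ 4) ∂μ)
        x := by
  intro x
  simp only [exponent_eq, Real.exp_add]
  obtain ⟨M, hM⟩ := ud_integrable μ hud
  have hMc : Continuous (fun w : Heis n => ((1 + ‖w‖) ^ M)⁻¹) :=
    Continuous.inv₀ (by fun_prop) fun z => by positivity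
  have hMi : Integrable (fun w : Heis n => ((1 + ‖w‖) ^ M)⁻¹) μ := by
    refine ⟨hMc.aestronglyMeasurable, ?_⟩
    rw [hasFiniteIntegral_iff_ofReal (Eventually.of_forall fun z => by positivity)]
    exact hM.lt_top
  have hwc : Continuous (fun z : Heis n => Real.exp (-s * (‖z.1‖ ^ 4 + z.2 ^ 2))) := by fun_prop
  have key := quad_laplace_analytic μ s hs (fun z : Heis n => ‖z.1‖ ^ 2) (fun z => z.2)
    ell1 ell2 (fun z : Heis n => Real.exp (-s * (‖z.1‖ ^ 4 + z.2 ^ 2)))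
    (by fun_prop) continuous_snd continuous_ell1 continuous_ell2 hwc
    (fun z => (Real.exp_pos _).le) (by
      intro δ hδ
      obtain ⟨K, hK⟩ := real_bound s (δ * s) (4 * n) M hs (by positivity) (by positivity)
        (by positivity)
      refine (hMi.const_mul (Real.exp K)).mono' ?_ (Eventually.of_forall fun z => ?_)
      · have e1 := continuous_ell1 (n := n)
        have e2 := continuous_ell2 (n := n)
        refine Continuous.aestronglyMeasurable (Continuous.mul (Real.continuous_exp.comp ?_) hwc)
        fun_prop
      · rw [Real.norm_of_nonneg (by positivity), ← Real.exp_add]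
        have h1 := hK ‖z.1‖ |z.2| (norm_nonneg _) (abs_nonneg _)
        rw [sq_abs] at h1
        have n1 := norm_ell1_le z
        have n2 := norm_ell2_le z
        have h2 : δ * (s * (2 * |‖z.1‖ ^ 2| * ‖ell1 z‖ + 2 * |z.2| * ‖ell2 z‖
            + (‖ell1 z‖ ^ 2 + ‖ell2 z‖ ^ 2))) ≤ δ * (s * (2 * ‖z.1‖ ^ 2 * (2 * ‖z.1‖ + 1)
            + 2 * |z.2| * (1 + 4 * n * ‖z.1‖)
            + ((2 * ‖z.1‖ + 1) ^ 2 + (1 + 4 * n * ‖z.1‖) ^ 2))) := by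
          rw [abs_of_nonneg (by positivity : 0 ≤ ‖z.1‖ ^ 2)]
          gcongr
        have h3 : ‖z‖ ≤ ‖z.1‖ + |z.2| := by
          rw [Prod.norm_def]
          exact max_le (by linarith [abs_nonneg z.2]) (by
            rw [Real.norm_eq_abs]; linarith [norm_nonneg z.1])
        have h4 : (M : ℝ) * ‖z‖ ≤ M * (‖z.1‖ + |z.2|) := by gcongr
        have h5 : Real.exp (-(M * ‖z‖)) ≤ ((1 + ‖z‖) ^ M)⁻¹ := by
          rw [Real.exp_neg, Real.exp_nat_mul]
          gcongr
          linarith [Real.add_one_le_exp ‖z‖]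
        calc _ ≤ Real.exp (K + -(M * ‖z‖)) := Real.exp_le_exp.2 (by linarith)
          _ = Real.exp K * Real.exp (-(M * ‖z‖)) := Real.exp_add _ _
          _ ≤ _ := by gcongr)
    (ee x)
  exact key.comp (analyticAt_ee x)
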